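/- For every positive integer m there exists δ > 0 such that for all p ∈ (p_0, p_0 + δ), the integer n(p) exists and n(p) > m. -/

import Mathlib

/-- `v p n` is the optimal expected number of heads in the coin game with `n` coins,
each landing heads with probability `p`. -/
noncomputable def v (p : ℝ) : ℕ → ℝ
  | 0 => 0
  | n + 1 =>
      ((n : ℝ) + 1) * p ^ (n + 1) + v p n * (1 - p) ^ (n + 1) +
        ∑ j ∈ (Finset.Icc 1 n).attach,
          (((n + 1).choose j.1 : ℕ) : ℝ) * p ^ (j.1 : ℕ) * (1 - p) ^ (n + 1 - j.1) *
            ((Finset.Icc 1 j.1).attach.sup'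
              (Finset.attach_nonempty_iff.mpr
                (Finset.nonempty_Icc.mpr (Finset.mem_Icc.mp j.2).1))
              (fun i => v p (n + 1 - i.1) + (i.1 : ℝ)))
decreasing_by
  · omega
  · have h := (Finset.mem_Icc.mp i.2).1
    omega

/-- `s p n = v p n - n + 1 - p`. -/
noncomputable def s (p : ℝ) (n : ℕ) : ℝ := v p n - n + 1 - p

/-- `IsNp p m` asserts that `m` is the smallest integer `n ≥ 2` with `s p n ≥ 0`. -/
def IsNp (p : ℝ) (m : ℕ) : Prop :=
  2 ≤ m ∧ 0 ≤ s p m ∧ ∀ k : ℕ, 2 ≤ k → 0 ≤ s p k → m ≤ k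

lemma sum_weights (p : ℝ) (n : ℕ) :
    ∑ j ∈ Finset.Icc 1 n, p ^ j * (1 - p) ^ (n + 1 - j) * ((n + 1).choose j : ℝ) =
      1 - p ^ (n + 1) - (1 - p) ^ (n + 1) := by
  have h := add_pow p (1 - p) (n + 1)
  rw [Finset.sum_range_succ, Finset.range_eq_Ico, Finset.sum_eq_sum_Ico_succ_bot (by omega)] at h
  have hIcc : Finset.Icc 1 n = Finset.Ico (0 + 1) (n + 1) := by
    ext
    simp
  rw [hIcc]
  simp only [add_sub_cancel, one_pow, pow_zero, Nat.choose_zero_right, Nat.choose_self,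
    Nat.sub_self, Nat.sub_zero, Nat.cast_one, mul_one, one_mul] at h
  linarith

/-- The recursion for `s`, with `M j` the maximum of `s p (n + 1 - i)` over `1 ≤ i ≤ j`. -/
lemma s_succ (p : ℝ) (n : ℕ) : ∃ M : ℕ → ℝ,
    s p (n + 1) = p ^ (n + 1) * (1 - p) + (s p n - 1) * (1 - p) ^ (n + 1) +
      ∑ j ∈ Finset.Icc 1 n, p ^ j * (1 - p) ^ (n + 1 - j) * ((n + 1).choose j : ℝ) * M j ∧
    ∀ j ∈ Finset.Icc 1 n, (∃ i ∈ Finset.Icc 1 j, M j = s p (n + 1 - i)) ∧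
      ∀ i ∈ Finset.Icc 1 j, s p (n + 1 - i) ≤ M j := by
  classical
  have hne (j : ℕ) (hj : j ∈ Finset.Icc 1 n) : (Finset.Icc 1 j).attach.Nonempty :=
    Finset.attach_nonempty_iff.mpr (Finset.nonempty_Icc.mpr (Finset.mem_Icc.mp hj).1)
  set V : ℕ → ℝ := fun j => if hj : j ∈ Finset.Icc 1 n then
    (Finset.Icc 1 j).attach.sup' (hne j hj) (fun i => v p (n + 1 - i.1) + (i.1 : ℝ)) else 0
    with hV
  have hcast {j i : ℕ} (hj : j ∈ Finset.Icc 1 n) (hi : i ∈ Finset.Icc 1 j) :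
      s p (n + 1 - i) = v p (n + 1 - i) + i - n - p := by
    simp only [Finset.mem_Icc] at hj hi
    rw [s, Nat.cast_sub (by omega)]
    push_cast
    ring
  refine ⟨fun j => V j - n - p, ?_, fun j hj => ⟨?_, fun i hi => ?_⟩⟩
  · have hsum : (∑ j ∈ (Finset.Icc 1 n).attach,
          (((n + 1).choose j.1 : ℕ) : ℝ) * p ^ (j.1 : ℕ) * (1 - p) ^ (n + 1 - j.1) *
            ((Finset.Icc 1 j.1).attach.sup' (hne j.1 j.2)
              (fun i => v p (n + 1 - i.1) + (i.1 : ℝ)))) =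
        ∑ j ∈ Finset.Icc 1 n, p ^ j * (1 - p) ^ (n + 1 - j) * ((n + 1).choose j : ℝ) * V j := by
      rw [← Finset.sum_attach (Finset.Icc 1 n)]
      refine Finset.sum_congr rfl fun j _ => ?_
      rw [hV]
      simp only [j.2, dif_pos]
      ring
    have hw := sum_weights p n
    have hv : v p (n + 1) = ((n : ℝ) + 1) * p ^ (n + 1) + v p n * (1 - p) ^ (n + 1) +
        ∑ j ∈ Finset.Icc 1 n, p ^ j * (1 - p) ^ (n + 1 - j) * ((n + 1).choose j : ℝ) * V j := by
      rw [← hsum, v]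
    have hsplit : ∑ j ∈ Finset.Icc 1 n,
          p ^ j * (1 - p) ^ (n + 1 - j) * ((n + 1).choose j : ℝ) * (V j - n - p) =
        ∑ j ∈ Finset.Icc 1 n, p ^ j * (1 - p) ^ (n + 1 - j) * ((n + 1).choose j : ℝ) * V j -
          (n + p) * (1 - p ^ (n + 1) - (1 - p) ^ (n + 1)) := by
      rw [← hw, Finset.mul_sum, ← Finset.sum_sub_distrib]
      exact Finset.sum_congr rfl fun j _ => by ring
    rw [hsplit, s, hv, s]
    push_cast
    ring
  · obtain ⟨i, _, hi⟩ := Finset.exists_mem_eq_sup' (hne j hj)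
      (fun i => v p (n + 1 - i.1) + (i.1 : ℝ))
    refine ⟨i.1, i.2, ?_⟩
    simp only [hV, hj, dif_pos]
    rw [hi, hcast hj i.2]
  · have := Finset.le_sup' (fun i : Finset.Icc 1 j => v p (n + 1 - i.1) + (i.1 : ℝ))
      (Finset.mem_attach _ ⟨i, hi⟩)
    rw [hcast hj hi]
    simp only [hV, hj, dif_pos]
    simp only at this
    linarith

lemma s_zero (p : ℝ) : s p 0 = 1 - p := by simp [s, v]

lemma s_one (p : ℝ) : s p 1 = 0 := by
  obtain ⟨M, hM, -⟩ := s_succ p 0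
  rw [hM]
  simp [s_zero]

lemma s_two (p : ℝ) : s p 2 = (1 - p) * (p ^ 2 + p - 1) := by
  obtain ⟨M, hM, hmax⟩ := s_succ p 1
  obtain ⟨i, hi, hMi⟩ := (hmax 1 (by simp)).1
  obtain rfl : i = 1 := by simpa using hi
  rw [hM]
  simp [hMi, s_one]
  ring

lemma continuous_v (n : ℕ) : Continuous fun p => v p n := by
  induction n using Nat.strong_induction_on with
  | _ n ih =>
    cases n with
    | zero => simpa [v] using continuous_const
    | succ n =>
      have h := ih n (by omega)
      simp only [v]
      refine Continuous.add (by fun_prop) (continuous_finsetSum _ fun j _ => ?_)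
      refine Continuous.mul (by fun_prop) ?_
      refine Continuous.finset_sup'_apply _ fun i _ => ?_
      have hi := (Finset.mem_Icc.mp i.2).1
      exact (ih (n + 1 - i.1) (by omega)).add continuous_const

lemma continuous_s (n : ℕ) : Continuous fun p => s p n := by
  have := continuous_v n
  unfold s
  fun_prop

lemma weight_nonneg {p : ℝ} (h0 : 0 ≤ p) (h1 : p ≤ 1) (n j : ℕ) :
    0 ≤ p ^ j * (1 - p) ^ (n + 1 - j) * ((n + 1).choose j : ℝ) := by
  have := sub_nonneg.mpr h1
  positivity

lemma s_succ_le {p : ℝ} (h0 : 0 ≤ p) (h1 : p ≤ 1)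
    {n : ℕ} {b : ℕ → ℝ}
    (hb : ∀ j ∈ Finset.Icc 1 n, ∀ i ∈ Finset.Icc 1 j, s p (n + 1 - i) ≤ b j) :
    s p (n + 1) ≤ p ^ (n + 1) * (1 - p) + (s p n - 1) * (1 - p) ^ (n + 1) +
      ∑ j ∈ Finset.Icc 1 n, p ^ j * (1 - p) ^ (n + 1 - j) * ((n + 1).choose j : ℝ) * b j := by
  obtain ⟨M, hM, hmax⟩ := s_succ p n
  rw [hM]
  gcongr with j hj
  obtain ⟨i, hi, h⟩ := (hmax j hj).1
  exact h ▸ hb j hj i hi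

lemma s_succ_ge {p : ℝ} (h0 : 0 ≤ p) (h1 : p ≤ 1) (n : ℕ) :
    s p n + p ^ (n + 1) * (1 - p - s p n) - (1 - p) ^ (n + 1) ≤ s p (n + 1) := by
  obtain ⟨M, hM, hmax⟩ := s_succ p n
  have h : ∑ j ∈ Finset.Icc 1 n, p ^ j * (1 - p) ^ (n + 1 - j) * ((n + 1).choose j : ℝ) * s p n ≤
      ∑ j ∈ Finset.Icc 1 n, p ^ j * (1 - p) ^ (n + 1 - j) * ((n + 1).choose j : ℝ) * M j := by
    gcongr with j hj
    exact (hmax j hj).2 1 (by simp at hj ⊢; omega)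
  rw [← Finset.sum_mul, sum_weights] at h
  linarith

lemma s_le {p : ℝ} (h0 : 0 ≤ p) (h1 : p ≤ 1) (n : ℕ) : s p n ≤ 1 - p := by
  induction n using Nat.strong_induction_on with
  | _ n ih =>
    cases n with
    | zero => exact (s_zero p).le
    | succ n =>
      have h := s_succ_le h0 h1 (n := n) (b := fun _ => 1 - p) fun j _ i hi =>
        ih _ (by simp at hi; omega)
      rw [← Finset.sum_mul, sum_weights] at h
      have hn := ih n (by omega)
      have := mul_nonneg (sub_nonneg.mpr (show s p n ≤ 1 - p + 1 by linarith))
        (pow_nonneg (sub_nonneg.mpr h1) (n + 1))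
      linarith

lemma monotone_s_sub_pow {p : ℝ} (h0 : 1 / 2 ≤ p) (h1 : p ≤ 1) :
    Monotone fun n => s p n - (1 - p) ^ n := by
  refine monotone_nat_of_le_succ fun n => ?_
  have h := s_succ_ge (by linarith) h1 n
  have h2 := mul_nonneg (pow_nonneg (show 0 ≤ p by linarith) (n + 1))
    (sub_nonneg.mpr (s_le (by linarith) h1 n))
  have h3 : (1 - p) ^ (n + 1) ≤ (1 - p) ^ n * (1 / 2) := by
    rw [pow_succ]
    have := pow_nonneg (sub_nonneg.mpr h1) n
    gcongr
    linarith
  linarith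

lemma dist_s_succ_le {p : ℝ} (h0 : 1 / 2 ≤ p) (h1 : p ≤ 31 / 50) (n : ℕ) :
    dist (s p n) (s p (n + 1)) ≤ 2 * (4 / 5) ^ n := by
  have hp0 : 0 ≤ p := by linarith
  have hp1 : p ≤ 1 := by linarith
  have hq : 0 ≤ 1 - p := by linarith
  have mono := monotone_s_sub_pow h0 hp1
  have hlow := mono (Nat.le_succ n)
  have hge := mono (Nat.zero_le n)
  simp only [Nat.succ_eq_add_one, s_zero, pow_zero] at hlow hge
  have hqn : (1 - p) ^ n ≤ (4 / 5) ^ n := by gcongr; linarith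
  have hpn : p ^ (n + 1) ≤ (4 / 5) ^ n := by
    calc p ^ (n + 1) ≤ p ^ n := pow_le_pow_of_le_one hp0 hp1 (by omega)
      _ ≤ _ := by gcongr; linarith
  have hqn0 := pow_nonneg hq n
  have hup := s_succ_le hp0 hp1 (n := n) (b := fun j => s p n + (1 - p) ^ (n + 1 - j))
    fun j hj i hi => by
      simp only [Finset.mem_Icc] at hj hi
      have h := mono (show n + 1 - i ≤ n by omega)
      have h' : (1 - p) ^ (n + 1 - i) ≤ (1 - p) ^ (n + 1 - j) :=
        pow_le_pow_of_le_one hq (by linarith) (by omega)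
      simp only at h
      linarith
  have hsum : ∑ j ∈ Finset.Icc 1 n, p ^ j * (1 - p) ^ (n + 1 - j) * ((n + 1).choose j : ℝ) *
      (1 - p) ^ (n + 1 - j) ≤ (4 / 5) ^ n := by
    calc _ ≤ ∑ j ∈ Finset.range (n + 1 + 1), p ^ j * (1 - p) ^ (n + 1 - j) *
          ((n + 1).choose j : ℝ) * (1 - p) ^ (n + 1 - j) := by
          refine Finset.sum_le_sum_of_subset_of_nonneg (fun j hj => ?_) fun j _ _ =>
            mul_nonneg (weight_nonneg hp0 hp1 n j) (pow_nonneg hq _)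
          simp at hj ⊢
          omega
      _ = (p + (1 - p) * (1 - p)) ^ (n + 1) := by
          rw [add_pow]
          refine Finset.sum_congr rfl fun j _ => ?_
          rw [mul_pow]
          ring
      _ ≤ (4 / 5) ^ (n + 1) := by
          gcongr
          nlinarith
      _ ≤ (4 / 5) ^ n := pow_le_pow_of_le_one (by norm_num) (by norm_num) (by omega)
  simp only [mul_add, Finset.sum_add_distrib] at hup
  rw [← Finset.sum_mul, sum_weights] at hup
  have hpow : p ^ (n + 1) * (1 - p - s p n) ≤ p ^ (n + 1) * 1 := by
    gcongr
    linarith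
  have := pow_nonneg hq (n + 1)
  rw [Real.dist_eq, abs_le]
  constructor <;> linarith

lemma continuousOn_of_tendsto_s {S : ℝ → ℝ}
    (hS : ∀ p : ℝ, 1 / 2 ≤ p → p ≤ 1 →
      Filter.Tendsto (fun n : ℕ => s p n) Filter.atTop (nhds (S p))) :
    ContinuousOn S (Set.Icc (1 / 2) (31 / 50)) := by
  have hunif : TendstoUniformlyOn (fun n p => s p n) S Filter.atTop
      (Set.Icc (1 / 2) (31 / 50)) := by
    rw [Metric.tendstoUniformlyOn_iff]
    intro ε hε
    have hlim : Filter.Tendsto (fun n : ℕ => 2 * (4 / 5 : ℝ) ^ n / (1 - 4 / 5))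
        Filter.atTop (nhds 0) := by
      simpa using ((tendsto_pow_atTop_nhds_zero_of_lt_one (r := (4 / 5 : ℝ))
        (by norm_num) (by norm_num)).const_mul 2).div_const (1 - 4 / 5)
    filter_upwards [hlim.eventually_lt_const hε] with n hn p hp
    rw [dist_comm]
    exact (dist_le_of_le_geometric_of_tendsto (4 / 5) 2 (by norm_num)
      (dist_s_succ_le hp.1 hp.2) (hS p hp.1 (by linarith [hp.2])) n).trans_lt hn
  exact hunif.continuousOn (Filter.Frequently.of_forall fun n => (continuous_s n).continuousOn)

/-- Once some `s p n` with `n ≥ 2` is nonnegative, the sequence stays positive, and `1 - p < p`. -/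
lemma s_pos_of_nonneg {p : ℝ} (h0 : 0 ≤ p) (h1 : p < 1) {n : ℕ} (hn : 2 ≤ n) (hs : 0 ≤ s p n) :
    1 - p < p ∧ ∀ᶠ k in Filter.atTop, 0 < s p k := by
  classical
  have hex : ∃ n, 2 ≤ n ∧ 0 ≤ s p n := ⟨n, hn, hs⟩
  obtain ⟨hN, hsN⟩ := Nat.find_spec hex
  have hmin {m : ℕ} (hm : m < Nat.find hex) (hm1 : 1 ≤ m) : s p m ≤ 0 := by
    rcases hm1.eq_or_lt with rfl | hm2
    · exact (s_one p).le
    · by_contra! h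
      exact Nat.find_min hex hm ⟨hm2, h.le⟩
  obtain ⟨N, hNeq⟩ : ∃ N, Nat.find hex = N + 1 := ⟨Nat.find hex - 1, by omega⟩
  rw [hNeq] at hN hsN hmin
  have hq : 0 < 1 - p := by linarith
  have hup := s_succ_le h0 h1.le (n := N) (b := fun _ => 0) fun j hj i hi => by
    simp only [Finset.mem_Icc] at hj hi
    exact hmin (by omega) (by omega)
  simp only [mul_zero, Finset.sum_const_zero, add_zero] at hup
  have hNneg := mul_nonneg (neg_nonneg.mpr (hmin (Nat.lt_succ_self N) (by omega)))
    (pow_nonneg hq.le (N + 1))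
  have hpow : (1 - p) ^ (N + 1) ≤ p ^ (N + 1) * (1 - p) := by linarith
  have hqN := pow_pos hq (N + 1)
  have hlt : 1 - p < p := by
    by_contra! h
    have h2 : p ^ (N + 1) ≤ (1 - p) ^ (N + 1) := by gcongr
    have hp : 0 < p := by
      rcases h0.eq_or_lt with rfl | h
      · simp at hpow
        linarith
      · exact h
    nlinarith
  have hpowk (k : ℕ) (hk : N + 1 ≤ k) : (1 - p) ^ k ≤ p ^ k * (1 - p) := by
    induction k, hk using Nat.le_induction with
    | base => exact hpow
    | succ k _ ih =>
      calc (1 - p) ^ (k + 1) = (1 - p) ^ k * (1 - p) := pow_succ _ _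
        _ ≤ (p ^ k * (1 - p)) * p := by gcongr
        _ = _ := by ring
  have hstep (k : ℕ) (hk : N + 1 ≤ k) (hsk : 0 ≤ s p k) : 0 < s p (k + 1) := by
    have h := s_succ_ge h0 h1.le k
    have h2 := mul_nonneg hsk (sub_nonneg.mpr (pow_le_one₀ (n := k + 1) h0 h1.le))
    have h3 : (1 - p) ^ (k + 1) < p ^ (k + 1) * (1 - p) := by
      calc (1 - p) ^ (k + 1) = (1 - p) ^ k * (1 - p) := pow_succ _ _
        _ < (1 - p) ^ k * p := by gcongr
        _ ≤ (p ^ k * (1 - p)) * p := by gcongr; exact hpowk k hk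
        _ = _ := by ring
    linarith
  refine ⟨hlt, Filter.eventually_atTop.mpr ⟨N + 2, fun k hk => ?_⟩⟩
  induction k, hk using Nat.le_induction with
  | base => exact hstep _ le_rfl hsN
  | succ k hk ih => exact hstep k (by omega) ih.le

lemma not_tendsto_s_zero {p : ℝ} (h0 : 0 ≤ p) (h1 : p < 1) {n : ℕ} (hn : 2 ≤ n)
    (hs : 0 ≤ s p n) : ¬ Filter.Tendsto (fun n => s p n) Filter.atTop (nhds 0) := by
  intro hlim
  obtain ⟨hlt, hpos⟩ := s_pos_of_nonneg h0 h1 hn hs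
  have hq : 0 < 1 - p := by linarith
  have hsmall := hlim.eventually_lt_const (half_pos hq)
  have hbig := (tendsto_pow_atTop_atTop_of_one_lt ((one_lt_div hq).mpr hlt)).eventually_ge_atTop
    (2 / (1 - p))
  obtain ⟨N, hN⟩ := Filter.eventually_atTop.mp (hpos.and (hsmall.and hbig))
  have hinc (k : ℕ) (hk : N ≤ k) : s p N ≤ s p k := by
    induction k, hk using Nat.le_induction with
    | base => exact le_rfl
    | succ k hk ih =>
      refine ih.trans ?_
      have h := s_succ_ge h0 h1.le k
      have hb := (hN (k + 1) (by omega)).2.2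
      rw [div_pow, div_le_div_iff₀ hq (pow_pos hq _)] at hb
      have h2 : p ^ (k + 1) * ((1 - p) / 2) ≤ p ^ (k + 1) * (1 - p - s p k) := by
        gcongr
        linarith [(hN k hk).2.1]
      linarith
  have := ge_of_tendsto hlim (Filter.eventually_atTop.mpr ⟨N, hinc⟩)
  linarith [(hN N le_rfl).1]

theorem coin_game_np_arbitrarily_large (S : ℝ → ℝ)
    (hS : ∀ p : ℝ, 1 / 2 ≤ p → p ≤ 1 →
      Filter.Tendsto (fun n : ℕ => s p n) Filter.atTop (nhds (S p)))
    (p0 : ℝ) (hp0l : 1 / 2 ≤ p0) (hp0u : p0 < 1) (hp0z : S p0 = 0)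
    (hp0uniq : ∀ q : ℝ, 1 / 2 ≤ q → q < 1 → S q = 0 → q = p0) :
    ∀ m : ℕ, 0 < m → ∃ δ : ℝ, 0 < δ ∧ ∀ p : ℝ, p0 < p → p < p0 + δ →
      ∃ np : ℕ, IsNp p np ∧ m < np := by
  intro m _
  classical
  have hneg (n : ℕ) (hn : 2 ≤ n) : s p0 n < 0 := by
    by_contra! h
    exact not_tendsto_s_zero (by linarith) hp0u hn h (hp0z ▸ hS p0 hp0l hp0u.le)
  have hp0lt : p0 < 31 / 50 := by
    have h := hneg 2 le_rfl
    rw [s_two] at h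
    by_contra! h'
    have : 0 ≤ (1 - p0) * (p0 ^ 2 + p0 - 1) := mul_nonneg (by linarith) (by nlinarith)
    linarith
  have hSright : 0 < S (31 / 50) := by
    have hev := (s_pos_of_nonneg (p := 31 / 50) (by norm_num) (by norm_num) le_rfl
      (by rw [s_two]; norm_num)).2
    refine lt_of_le_of_ne (ge_of_tendsto (hS _ (by norm_num) (by norm_num))
      (hev.mono fun _ h => h.le)) fun h => ?_
    exact hp0lt.ne' (hp0uniq _ (by norm_num) (by norm_num) h.symm)
  have hSpos (p : ℝ) (hp : p0 < p) (hp' : p < 31 / 50) : 0 < S p := by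
    by_contra! h
    obtain ⟨x, hx, hx0⟩ := intermediate_value_Icc hp'.le
      ((continuousOn_of_tendsto_s hS).mono (Set.Icc_subset_Icc_left (by linarith)))
      ⟨h, hSright.le⟩
    have := hp0uniq x (by linarith [hx.1]) (by linarith [hx.2]) hx0
    linarith [hx.1]
  have hnear : ∀ᶠ p in nhds p0, ∀ k ∈ Finset.Icc 2 m, s p k < 0 :=
    (Filter.eventually_all_finset _).mpr fun k hk =>
      (continuous_s k).continuousAt.eventually_lt_const (hneg k (Finset.mem_Icc.mp hk).1)
  obtain ⟨ε, hε, hball⟩ := Metric.eventually_nhds_iff.mp hnear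
  refine ⟨min ε (31 / 50 - p0), lt_min hε (by linarith), fun p hp hpδ => ?_⟩
  have hpε : p < p0 + ε := hpδ.trans_le (by gcongr; exact min_le_left _ _)
  have hpr : p < 31 / 50 := by linarith [min_le_right ε (31 / 50 - p0)]
  have hex : ∃ n, 2 ≤ n ∧ 0 ≤ s p n := by
    obtain ⟨n, hn, hn2⟩ := (((hS p (by linarith) (by linarith)).eventually_const_lt
      (hSpos p hp hpr)).and (Filter.eventually_ge_atTop 2)).exists
    exact ⟨n, hn2, hn.le⟩
  obtain ⟨hf2, hfs⟩ := Nat.find_spec hex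
  refine ⟨Nat.find hex, ⟨hf2, hfs, fun k hk hsk => Nat.find_min' hex ⟨hk, hsk⟩⟩, ?_⟩
  by_contra! hle
  have hd : dist p p0 < ε := by
    rw [Real.dist_eq, abs_lt]
    constructor <;> linarith
  exact (hball hd _ (Finset.mem_Icc.mpr ⟨hf2, hle⟩)).not_ge hfs
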